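/- Let N := ker(π : F* → M), so that φ* factors through a surjection G* ↠ N. Then the natural map Hom_R(N,M) → Hom_R(G*,M) given by precomposition with the surjection G* ↠ N is an isomorphism of graded R-modules; in particular Hom_R(N,M) ≅ ⊕_{j=1}^{q} M(a_j), and the k-vector space of degree-preserving graded R-module homomorphisms from N to M has dimension Σ_{j=1}^{q} dim_k M_{a_j}, where M_{a} denotes the degree-a homogeneous component of M. -/

import Mathlib

set_option maxHeartbeats 1000000
set_option synthInstance.maxHeartbeats 400000

open CategoryTheory

noncomputable section

/-- `Ext^i_R(M, N)` as an object of `ModuleCat R`. -/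
abbrev extModule (R : Type) [CommRing R] (i : ℕ) (M N : Type)
    [AddCommGroup M] [Module R M] [AddCommGroup N] [Module R N] : ModuleCat R :=
  ((Ext R (ModuleCat.{0} R) i).obj (Opposite.op (ModuleCat.of R M))).obj (ModuleCat.of R N)

/-- The ideal `I_s(X)` generated by the `s × s` minors of a matrix `X`. -/
def minorsIdeal {R : Type*} [CommRing R] {m r : ℕ} (s : ℕ) (X : Matrix (Fin m) (Fin r) R) :
    Ideal R :=
  Ideal.span { d : R | ∃ (f : Fin s → Fin m) (g : Fin s → Fin r),
    Function.Injective f ∧ Function.Injective g ∧ d = (X.submatrix f g).det }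

/-- `depthIn J N` is the length of a maximal `N`-regular sequence contained in the ideal `J`,
i.e. the supremum of the lengths of `N`-regular sequences whose entries lie in `J`. -/
def depthIn {R : Type*} [CommRing R] (J : Ideal R) (N : Type*) [AddCommGroup N]
    [Module R N] : ℕ :=
  sSup {n : ℕ | ∃ rs : List R, rs.length = n ∧ (∀ r ∈ rs, r ∈ J) ∧
    RingTheory.Sequence.IsRegular N rs}

/-- The cokernel of the linear map `(Fin r → R) → (Fin m → R)` given by a matrix `X`
(`v ↦ X *ᵥ v`). -/
abbrev cokerOf {R : Type} [CommRing R] {m r : ℕ} (X : Matrix (Fin m) (Fin r) R) :=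
  (Fin m → R) ⧸ LinearMap.range X.mulVecLin

/-- The irrelevant maximal ideal `m = (x₀,…,xₙ)` of the polynomial ring. -/
def irrelevantIdeal (k : Type) [CommRing k] (n : ℕ) : Ideal (MvPolynomial (Fin (n + 1)) k) :=
  Ideal.span (Set.range MvPolynomial.X)

/-- The homogeneous component of (integer) degree `d` of a polynomial ring,
zero in negative degrees. -/
def homogPiece (k : Type) [CommSemiring k] (σ : Type) (d : ℤ) : Submodule k (MvPolynomial σ k) :=
  if 0 ≤ d then MvPolynomial.homogeneousSubmodule σ k d.toNat else ⊥

/-- The degree-`d` component of the shifted graded free module `⊕ᵢ R(-b i)`. -/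
def shiftedPiece (k : Type) [CommSemiring k] (σ : Type) {m : ℕ} (b : Fin m → ℤ) (d : ℤ) :
    Submodule k (Fin m → MvPolynomial σ k) :=
  Submodule.pi Set.univ fun i => homogPiece k σ (d - b i)

/-- Given gradings `𝒩` on `N` and `ℳ` on `M`, the `k`-submodule of `N →ₗ[R] M` consisting of
degree-preserving (i.e. homogeneous of degree zero) homomorphisms. -/
def degZeroHoms {k R N M : Type} [CommSemiring k] [CommRing R]
    [AddCommGroup N] [Module R N] [AddCommGroup M] [Module R M]
    [Module k M] [SMulCommClass R k M]
    (𝒩 : ℤ → Set N) (ℳ : ℤ → Submodule k M) : Submodule k (N →ₗ[R] M) where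
  carrier := {f | ∀ d, ∀ x ∈ 𝒩 d, f x ∈ ℳ d}
  add_mem' := fun hf hg d x hx => (ℳ d).add_mem (hf d x hx) (hg d x hx)
  zero_mem' := fun d x _ => (ℳ d).zero_mem
  smul_mem' := fun cc f hf d x hx => by
    simpa using (ℳ d).smul_mem cc (hf d x hx)

/-- The degree-`d` component of the cokernel of a degree-zero graded morphism into
`⊕ᵢ R(-b i)`: the image of the degree-`d` component of the free module. -/
def cokerPiece (k : Type) [CommRing k] (σ : Type) {m r : ℕ} (b : Fin m → ℤ)
    (X : Matrix (Fin m) (Fin r) (MvPolynomial σ k)) (d : ℤ) : Submodule k (cokerOf X) :=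
  Submodule.map ((LinearMap.range X.mulVecLin).mkQ.restrictScalars k) (shiftedPiece k σ b d)

/-- The order-preserving injection `Fin r → Fin s` (where `s = r + 1`) whose image misses
exactly the index `l`; used to delete the column `l` from a matrix. -/
def skipCol {r s : ℕ} (h : r + 1 = s) (l : Fin s) : Fin r → Fin s :=
  fun j => Fin.cast h ((Fin.cast h.symm l).succAbove j)

open scoped Pointwise

namespace BuchsbaumRim

section Exterior

variable {R V L L₂ : Type*} [CommRing R] [AddCommGroup V] [Module R V]
  [AddCommGroup L] [Module R L] [AddCommGroup L₂] [Module R L₂]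

/-- Contraction of an alternating form with a vector. -/
def contract (u : V) {n : ℕ} : (V [⋀^Fin (n + 1)]→ₗ[R] L) →ₗ[R] V [⋀^Fin n]→ₗ[R] L :=
  (LinearMap.applyₗ u) ∘ₗ AlternatingMap.curryLeftLinearMap

/-- Exterior multiplication of an alternating form by a linear functional. -/
def wedge (y : V →ₗ[R] R) {n : ℕ} : (V [⋀^Fin n]→ₗ[R] L) →ₗ[R] V [⋀^Fin (n + 1)]→ₗ[R] L :=
  AlternatingMap.alternatizeUncurryFinLM ∘ₗ LinearMap.smulRightₗ y

theorem contract_apply (u : V) {n : ℕ} (ω : V [⋀^Fin (n + 1)]→ₗ[R] L) (v : Fin n → V) :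
    contract u ω v = ω (Matrix.vecCons u v) := rfl

theorem wedge_apply (y : V →ₗ[R] R) {n : ℕ} (ω : V [⋀^Fin n]→ₗ[R] L) (v : Fin (n + 1) → V) :
    wedge y ω v = ∑ i : Fin (n + 1), (-1) ^ (i : ℕ) • y (v i) • ω (i.removeNth v) := by
  simp [wedge, AlternatingMap.alternatizeUncurryFin_apply]

theorem contract_compAlternatingMap (f : L →ₗ[R] L₂) (u : V) {n : ℕ}
    (ω : V [⋀^Fin (n + 1)]→ₗ[R] L) :
    contract u (f.compAlternatingMap ω) = f.compAlternatingMap (contract u ω) := rfl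

theorem contract_contract_self (u : V) {n : ℕ} (ω : V [⋀^Fin (n + 2)]→ₗ[R] L) :
    contract u (contract u ω) = 0 :=
  AlternatingMap.curryLeft_same ω u

theorem contract_add_left (u v : V) {n : ℕ} (ω : V [⋀^Fin (n + 1)]→ₗ[R] L) :
    contract (u + v) ω = contract u ω + contract v ω :=
  map_add ω.curryLeft u v

theorem contract_contract_add_swap (u v : V) {n : ℕ} (ω : V [⋀^Fin (n + 2)]→ₗ[R] L) :
    contract u (contract v ω) + contract v (contract u ω) = 0 := by
  have h := contract_contract_self (u + v) ω
  simpa [contract_add_left, contract_contract_self, add_comm] using h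

theorem contract_wedge_add_wedge_contract (u : V) (y : V →ₗ[R] R) {n : ℕ}
    (ω : V [⋀^Fin (n + 1)]→ₗ[R] L) :
    contract u (wedge y ω) + wedge y (contract u ω) = y u • ω := by
  ext v
  have hrem (i : Fin (n + 1)) : i.succ.removeNth (Matrix.vecCons u v : Fin (n + 2) → V) =
      Matrix.vecCons u (i.removeNth v) := by
    ext j
    refine Fin.cases ?_ (fun j => ?_) j <;> simp [Fin.removeNth]
  have h0 : (0 : Fin (n + 2)).removeNth (Matrix.vecCons u v : Fin (n + 2) → V) = v := by
    ext j; simp [Fin.removeNth]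
  simp only [AlternatingMap.add_apply, contract_apply, wedge_apply, AlternatingMap.smul_apply]
  rw [Fin.sum_univ_succ, h0]
  simp [hrem, pow_succ]

theorem contract_wedge_of_eq_zero {u : V} {y : V →ₗ[R] R} (h : y u = 0) {n : ℕ}
    (ω : V [⋀^Fin (n + 1)]→ₗ[R] L) :
    contract u (wedge y ω) = -wedge y (contract u ω) := by
  have := contract_wedge_add_wedge_contract u y ω
  rw [h, zero_smul] at this
  exact eq_neg_of_add_eq_zero_left this

/-- Iterated contraction with a family of vectors. -/
def iterContract {n : ℕ} : {k : ℕ} → (Fin k → V) →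
    (V [⋀^Fin (n + k)]→ₗ[R] L) →ₗ[R] V [⋀^Fin n]→ₗ[R] L
  | 0, _ => LinearMap.id
  | _ + 1, ψ => iterContract (Fin.tail ψ) ∘ₗ contract (ψ 0)

theorem iterContract_succ {n k : ℕ} (ψ : Fin (k + 1) → V) (ω : V [⋀^Fin (n + (k + 1))]→ₗ[R] L) :
    iterContract ψ ω = iterContract (Fin.tail ψ) (contract (n := n + k) (ψ 0) ω) := rfl

theorem iterContract_compAlternatingMap (f : L →ₗ[R] L₂) {n k : ℕ} (ψ : Fin k → V)
    (ω : V [⋀^Fin (n + k)]→ₗ[R] L) :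
    iterContract ψ (f.compAlternatingMap ω) = f.compAlternatingMap (iterContract ψ ω) := by
  induction k with
  | zero => rfl
  | succ k ih => exact ih (Fin.tail ψ) (contract (n := n + k) (ψ 0) ω)

theorem iterContract_contract {n k : ℕ} (ψ : Fin k → V) (i : Fin k)
    (ω : V [⋀^Fin (n + k + 1)]→ₗ[R] L) :
    iterContract ψ (contract (ψ i) ω) = 0 := by
  induction k with
  | zero => exact i.elim0
  | succ k ih =>
    rw [iterContract_succ]
    refine Fin.cases ?_ (fun j => ?_) i
    · rw [contract_contract_self (n := n + k) (ψ 0) ω, map_zero]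
    · have h := contract_contract_add_swap (n := n + k) (ψ 0) (ψ j.succ) ω
      rw [eq_neg_of_add_eq_zero_left h, map_neg]
      have := ih (Fin.tail ψ) j (contract (n := n + k + 1) (ψ 0) ω)
      rw [neg_eq_zero]
      exact this

/-- A family of functionals dual to `ψ` up to the scalar `x`. -/
def IsScaledDual (x : R) {k : ℕ} (ψ : Fin k → V) (y : Fin k → V →ₗ[R] R) : Prop :=
  ∀ i j, y i (ψ j) = if i = j then x else 0

theorem IsScaledDual.tail {x : R} {k : ℕ} {ψ : Fin (k + 1) → V} {y : Fin (k + 1) → V →ₗ[R] R}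
    (h : IsScaledDual x ψ y) : IsScaledDual x (Fin.tail ψ) (Fin.tail y) := fun i j => by
  simp [Fin.tail, h i.succ j.succ]

/-- A form killed by all contractions with `ψ` becomes an iterated contraction after scaling. -/
theorem exists_iterContract_eq_pow_smul {x : R} {n k : ℕ} {ψ : Fin k → V}
    {y : Fin k → V →ₗ[R] R} (h : IsScaledDual x ψ y) (g : V [⋀^Fin n]→ₗ[R] L)
    (hg : ∀ i v, ψ i ∈ Set.range v → g v = 0) :
    ∃ ω : V [⋀^Fin (n + k)]→ₗ[R] L, iterContract ψ ω = x ^ k • g := by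
  suffices ∃ ω : V [⋀^Fin (n + k)]→ₗ[R] L, iterContract ψ ω = x ^ k • g ∧
      ∀ u, (∀ i, y i u = 0) → (∀ v, u ∈ Set.range v → g v = 0) →
        ∀ v, u ∈ Set.range v → ω v = 0 from this.imp fun _ h => h.1
  induction k with
  | zero => exact ⟨g, by simp [iterContract], fun u _ hu => hu⟩
  | succ k ih =>
    obtain ⟨ω, hω, hvan⟩ := ih h.tail fun i v hv => hg i.succ v hv
    have hzero : ∀ v, ψ 0 ∈ Set.range v → ω v = 0 :=
      hvan (ψ 0) (fun i => by simp [Fin.tail, h i.succ 0]) (hg 0)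
    refine ⟨wedge (y 0) ω, ?_, fun u hu hgu v hv => ?_⟩
    · rw [iterContract_succ]
      have : contract (n := n + k) (ψ 0) (wedge (y 0) ω) = x • ω := by
        ext v
        rw [contract_apply, wedge_apply, Fin.sum_univ_succ, Finset.sum_eq_zero]
        · have h0 : (0 : Fin (n + k + 1)).removeNth
              (Matrix.vecCons (ψ 0) v : Fin (n + k + 1) → V) = v := by
            ext j; simp [Fin.removeNth]
          simp [h0, h 0 0]
        · intro i _
          rw [hzero, smul_zero, smul_zero]
          have : 0 < n + k := i.pos
          refine ⟨⟨0, this⟩, ?_⟩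
          have hz : i.succ.succAbove ⟨0, this⟩ = 0 := by
            simp [Fin.succAbove, Fin.lt_def]
          simp [Fin.removeNth, hz]
      rw [this, map_smul, hω, pow_succ', mul_smul]
    · have hω0 := hvan u (fun i => hu i.succ) hgu
      obtain ⟨j, hj⟩ := hv
      rw [wedge_apply]
      refine Finset.sum_eq_zero fun i _ => ?_
      by_cases hij : i = j
      · rw [hij, hj, hu 0, zero_smul, smul_zero]
      · obtain ⟨l, hl⟩ := Fin.exists_succAbove_eq (Ne.symm hij)
        rw [hω0 _ ⟨l, by rw [Fin.removeNth, hl, hj]⟩, smul_zero, smul_zero]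

/-- A form killed by the iterated contraction is, after scaling, a sum of contractions. -/
theorem exists_pow_smul_eq_sum_contract {x : R} {n k : ℕ} {ψ : Fin k → V}
    {y : Fin k → V →ₗ[R] R} (h : IsScaledDual x ψ y) (ω : V [⋀^Fin (n + k)]→ₗ[R] L)
    (hω : iterContract ψ ω = 0) :
    ∃ ζ : Fin k → V [⋀^Fin (n + k + 1)]→ₗ[R] L, x ^ k • ω = ∑ i, contract (ψ i) (ζ i) := by
  induction k with
  | zero =>
    refine ⟨0, ?_⟩
    have : ω = 0 := hω
    simp [this]
  | succ k ih =>
    obtain ⟨ζ, hζ⟩ := ih h.tail (contract (n := n + k) (ψ 0) ω) hω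
    refine ⟨Fin.cons (x ^ k • wedge (y 0) ω) fun i => -wedge (y 0) (ζ i), ?_⟩
    have key := contract_wedge_add_wedge_contract (n := n + k) (ψ 0) (y 0) ω
    rw [h 0 0, if_pos rfl] at key
    rw [Fin.sum_univ_succ, pow_succ, mul_smul, ← key, smul_add, ← map_smul (wedge (y 0)), hζ,
      Fin.cons_zero, map_smul, map_sum]
    congr 1
    refine Finset.sum_congr rfl fun i _ => ?_
    have h0 : y 0 (ψ i.succ) = 0 := by simp [h 0 i.succ, (Fin.succ_ne_zero i).symm]
    rw [Fin.cons_succ, map_neg]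
    have hc := contract_wedge_of_eq_zero h0 (ζ i)
    exact (neg_eq_iff_eq_neg.mpr hc).symm

/-! ### Coefficients -/

theorem compAlternatingMap_surjective [Module.Free R V] {f : L →ₗ[R] L₂}
    (hf : Function.Surjective f) (n : ℕ) :
    Function.Surjective (f.compAlternatingMap : (V [⋀^Fin n]→ₗ[R] L) → V [⋀^Fin n]→ₗ[R] L₂) := by
  intro ω
  obtain ⟨g, hg⟩ := Module.projective_lifting_property f
    (exteriorPower.alternatingMapLinearEquiv ω) hf
  refine ⟨g.compAlternatingMap (exteriorPower.ιMulti R n), ?_⟩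
  ext v
  have := LinearMap.congr_fun hg (exteriorPower.ιMulti R n v)
  simpa using this

theorem exists_smul_eq_of_mkQ_comp_eq_zero {x : R} (hx : IsSMulRegular L x) {n : ℕ}
    (ω : V [⋀^Fin n]→ₗ[R] L)
    (hω : (Submodule.mkQ (x • ⊤ : Submodule R L)).compAlternatingMap ω = 0) :
    ∃ ω' : V [⋀^Fin n]→ₗ[R] L, ω = x • ω' := by
  let e := LinearEquiv.ofInjective (LinearMap.lsmul R L x) hx
  have hmem : ∀ v, ω v ∈ LinearMap.range (LinearMap.lsmul R L x) := fun v => by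
    have := AlternatingMap.congr_fun hω v
    simp only [LinearMap.compAlternatingMap_apply, Submodule.mkQ_apply, AlternatingMap.zero_apply,
      Submodule.Quotient.mk_eq_zero, Submodule.mem_smul_pointwise_iff_exists] at this
    obtain ⟨l, -, hl⟩ := this
    exact ⟨l, hl⟩
  refine ⟨e.symm.toLinearMap.compAlternatingMap (ω.codRestrict _ hmem), ?_⟩
  ext v
  have := congrArg Subtype.val (e.apply_symm_apply ⟨ω v, hmem v⟩)
  exact this.symm

end Exterior

section Koszul

variable {R V L L₂ : Type*} [CommRing R] [AddCommGroup V] [Module R V]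
  [AddCommGroup L] [Module R L] [AddCommGroup L₂] [Module R L₂] {p : ℕ}

/-- The Koszul differential of the linear forms `∑ φ b ⊗ t b` with coefficients in inverse
polynomials, on which `t b` acts by shifting exponents. -/
def koszulD (φ : Fin p → V) {n : ℕ} (ω : (Fin p → ℕ) → V [⋀^Fin (n + 1)]→ₗ[R] L)
    (α : Fin p → ℕ) : V [⋀^Fin n]→ₗ[R] L :=
  ∑ b, contract (φ b) (ω (α + Pi.single b 1))

theorem koszulD_smul (φ : Fin p → V) {n : ℕ} (x : R)
    (ω : (Fin p → ℕ) → V [⋀^Fin (n + 1)]→ₗ[R] L) :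
    koszulD φ (x • ω) = x • koszulD φ ω := by
  ext α : 1
  simp [koszulD, Finset.smul_sum]

theorem koszulD_add (φ : Fin p → V) {n : ℕ}
    (ω ω' : (Fin p → ℕ) → V [⋀^Fin (n + 1)]→ₗ[R] L) :
    koszulD φ (ω + ω') = koszulD φ ω + koszulD φ ω' := by
  ext α : 1
  simp [koszulD, Finset.sum_add_distrib]

theorem koszulD_compAlternatingMap (φ : Fin p → V) (f : L →ₗ[R] L₂) {n : ℕ}
    (ω : (Fin p → ℕ) → V [⋀^Fin (n + 1)]→ₗ[R] L) (α : Fin p → ℕ) :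
    koszulD φ (fun β => f.compAlternatingMap (ω β)) α = f.compAlternatingMap (koszulD φ ω α) := by
  simp only [koszulD, contract_compAlternatingMap]
  exact (map_sum (f.compAlternatingMapₗ R) _ _).symm

theorem koszulD_congr (φ : Fin p → V) {n : ℕ} {ω ω' : (Fin p → ℕ) → V [⋀^Fin (n + 1)]→ₗ[R] L}
    (h : ∀ α ≠ 0, ω α = ω' α) : koszulD φ ω = koszulD φ ω' := by
  ext α : 1
  refine Finset.sum_congr rfl fun b _ => ?_
  rw [h]
  intro h0
  simpa using congrFun h0 b

theorem koszulD_koszulD (φ : Fin p → V) {n : ℕ}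
    (ω : (Fin p → ℕ) → V [⋀^Fin (n + 2)]→ₗ[R] L) : koszulD φ (koszulD φ ω) = 0 := by
  ext α : 1
  simp only [koszulD, map_sum, Pi.zero_apply]
  rw [← Finset.sum_product']
  refine Finset.sum_involution (fun a _ => a.swap) ?_ ?_ (by simp) (by simp)
  · rintro ⟨b, b'⟩ -
    simp only [Prod.fst_swap, Prod.snd_swap]
    rw [add_right_comm α (Pi.single b' 1) (Pi.single b 1)]
    exact contract_contract_add_swap _ _ _
  · rintro ⟨b, b'⟩ - hne heq
    obtain rfl : b' = b := by simpa using congrArg Prod.fst heq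
    exact hne (contract_contract_self _ _)

/-- The partial homotopy in the variable `b`. -/
def homotopy (y : V →ₗ[R] R) (b : Fin p) {n : ℕ} (ω : (Fin p → ℕ) → V [⋀^Fin n]→ₗ[R] L)
    (α : Fin p → ℕ) : V [⋀^Fin (n + 1)]→ₗ[R] L :=
  if α b = 0 then 0 else wedge y (ω (α - Pi.single b 1))

theorem koszulD_homotopy {x : R} {φ : Fin p → V} {y : Fin p → V →ₗ[R] R}
    (h : IsScaledDual x φ y) (b : Fin p) {n : ℕ} (ω : (Fin p → ℕ) → V [⋀^Fin (n + 1)]→ₗ[R] L)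
    (hω : koszulD φ ω = 0) (α : Fin p → ℕ) :
    koszulD φ (homotopy (y b) b ω) α =
      x • ω α - if α b = 0 then wedge (y b) (contract (φ b) (ω α)) else 0 := by
  have hb : contract (φ b) (homotopy (y b) b ω (α + Pi.single b 1)) =
      x • ω α - wedge (y b) (contract (φ b) (ω α)) := by
    have := contract_wedge_add_wedge_contract (φ b) (y b) (ω α)
    rw [h b b, if_pos rfl] at this
    simp [homotopy, ← this]
  have hne (b' : Fin p) (hb' : b' ≠ b) :
      contract (φ b') (homotopy (y b) b ω (α + Pi.single b' 1)) =
        if α b = 0 then 0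
        else -wedge (y b) (contract (φ b') (ω (α - Pi.single b 1 + Pi.single b' 1))) := by
    have h0 : y b (φ b') = 0 := by simp [h b b', hb'.symm]
    by_cases hα : α b = 0
    · simp [homotopy, hα, hb'.symm]
    · have hidx : α + Pi.single b' 1 - Pi.single b 1 = α - Pi.single b 1 + Pi.single b' 1 := by
        ext i
        by_cases hi : i = b
        · subst hi; simp [hb'.symm]
        · simp [hi]
      simp [homotopy, hα, hb'.symm, contract_wedge_of_eq_zero h0, hidx]
  rw [koszulD, ← Finset.add_sum_erase _ _ (Finset.mem_univ b), hb,
    Finset.sum_congr rfl fun b' hb' => hne b' (Finset.ne_of_mem_erase hb')]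
  by_cases hα : α b = 0
  · simp [hα]
  · have hcyc := congrFun hω (α - Pi.single b 1)
    rw [koszulD, ← Finset.add_sum_erase _ _ (Finset.mem_univ b)] at hcyc
    have hidx : α - Pi.single b 1 + Pi.single b 1 = α := by
      ext i
      by_cases hi : i = b
      · subst hi; simp; omega
      · simp [hi]
    rw [hidx, Pi.zero_apply] at hcyc
    simp only [hα, if_false, Finset.sum_neg_distrib, ← map_sum, sub_zero]
    rw [eq_neg_of_add_eq_zero_left hcyc, map_neg]
    abel

/-- Koszul cycles without constant term are boundaries after scaling. -/
theorem exists_pow_smul_eq_koszulD {x : R} {φ : Fin p → V} {y : Fin p → V →ₗ[R] R}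
    (h : IsScaledDual x φ y) {n : ℕ} (ω : (Fin p → ℕ) → V [⋀^Fin (n + 1)]→ₗ[R] L)
    (hω : koszulD φ ω = 0) (hω0 : ω 0 = 0) :
    ∃ (N : ℕ) (w : (Fin p → ℕ) → V [⋀^Fin (n + 2)]→ₗ[R] L), x ^ N • ω = koszulD φ w := by
  suffices ∀ s : Finset (Fin p), ∃ (N : ℕ) (w : (Fin p → ℕ) → V [⋀^Fin (n + 2)]→ₗ[R] L)
      (η : (Fin p → ℕ) → V [⋀^Fin (n + 1)]→ₗ[R] L), x ^ N • ω = koszulD φ w + η ∧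
        koszulD φ η = 0 ∧ η 0 = 0 ∧ ∀ α, (∃ b ∈ s, α b ≠ 0) → η α = 0 by
    obtain ⟨N, w, η, hN, -, h0, hη⟩ := this Finset.univ
    refine ⟨N, w, ?_⟩
    rw [hN, add_eq_left]
    ext α : 1
    by_cases hα : α = 0
    · rw [hα, h0, Pi.zero_apply]
    · obtain ⟨b, hb⟩ := Function.ne_iff.mp hα
      exact hη α ⟨b, Finset.mem_univ b, hb⟩
  intro s
  induction s using Finset.induction_on with
  | empty => exact ⟨0, 0, ω, by ext α; simp [koszulD], hω, hω0, by simp⟩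
  | insert b s _ ih =>
    obtain ⟨N, w, η, hN, hη, h0, hs⟩ := ih
    let η' : (Fin p → ℕ) → V [⋀^Fin (n + 1)]→ₗ[R] L :=
      fun α => if α b = 0 then wedge (y b) (contract (φ b) (η α)) else 0
    have hη' : koszulD φ (homotopy (y b) b η) + η' = x • η := by
      ext α : 1
      simp only [Pi.add_apply, koszulD_homotopy h b η hη, η', Pi.smul_apply, sub_add_cancel]
    refine ⟨N + 1, x • w + homotopy (y b) b η, η', ?_, ?_, ?_, ?_⟩
    · rw [koszulD_add, koszulD_smul, add_assoc, hη', ← smul_add, ← hN, pow_succ', mul_smul]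
    · have := congrArg (koszulD φ) hη'
      rwa [koszulD_add, koszulD_koszulD, zero_add, koszulD_smul, hη, smul_zero] at this
    · simp [η', h0]
    · rintro α ⟨c, hc, hα⟩
      rcases Finset.mem_insert.mp hc with rfl | hc
      · simp [η', hα]
      · simp [η', hs α ⟨c, hc, hα⟩]

theorem alternatingMap_eq_zero_of_lt {q n : ℕ} (hn : q < n)
    (ω : (Fin q → R) [⋀^Fin n]→ₗ[R] L) : ω = 0 :=
  (Pi.basisFun R (Fin q)).ext_alternating fun v hv => by
    have := Fintype.card_le_of_injective v hv
    simp at this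
    omega

theorem exists_koszulD_add_smul [Module.Free R V] {x : R} (hx : IsSMulRegular L x) (φ : Fin p → V)
    {n : ℕ} (w : (Fin p → ℕ) → V [⋀^Fin n]→ₗ[R] L)
    (u : (Fin p → ℕ) → V [⋀^Fin (n + 1)]→ₗ[R] QuotSMulTop x L)
    (hu : (fun α => (Submodule.mkQ (x • ⊤ : Submodule R L)).compAlternatingMap (w α)) =
      koszulD φ u) :
    ∃ (u' : (Fin p → ℕ) → V [⋀^Fin (n + 1)]→ₗ[R] L) (w' : (Fin p → ℕ) → V [⋀^Fin n]→ₗ[R] L),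
      w = koszulD φ u' + x • w' := by
  choose u' hu' using fun α => compAlternatingMap_surjective
    (Submodule.mkQ_surjective (x • ⊤ : Submodule R L)) (n + 1) (u α)
  choose w' hw' using fun α => exists_smul_eq_of_mkQ_comp_eq_zero hx (w α - koszulD φ u' α) (by
    have h1 := congrFun hu α
    have h2 := koszulD_compAlternatingMap φ (Submodule.mkQ (x • ⊤ : Submodule R L)) u' α
    rw [show (fun β => (Submodule.mkQ (x • ⊤ : Submodule R L)).compAlternatingMap (u' β)) = u from
      funext hu'] at h2
    ext v
    have h3 := AlternatingMap.congr_fun (h1.trans h2) v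
    simpa [sub_eq_zero] using h3)
  refine ⟨u', w', ?_⟩
  ext α : 1
  rw [Pi.add_apply, Pi.smul_apply, ← hw']
  abel

/-- Depth sensitivity: a Koszul chain which is torsion modulo boundaries is a boundary. -/
theorem exists_eq_koszulD {q : ℕ} (φ : Fin p → Fin q → R) (rs : List R)
    (hrs : ∀ x ∈ rs, ∃ y, IsScaledDual x φ y) {L : Type*} [AddCommGroup L] [Module R L]
    (hreg : RingTheory.Sequence.IsWeaklyRegular L rs) {n : ℕ} (hn : q < n + rs.length)
    (ω : (Fin p → ℕ) → (Fin q → R) [⋀^Fin n]→ₗ[R] L)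
    (hω : ∀ x ∈ rs, ∃ (N : ℕ) (w : (Fin p → ℕ) → (Fin q → R) [⋀^Fin (n + 1)]→ₗ[R] L),
      x ^ N • ω = koszulD φ w) :
    ∃ w : (Fin p → ℕ) → (Fin q → R) [⋀^Fin (n + 1)]→ₗ[R] L, ω = koszulD φ w := by
  induction rs generalizing n L with
  | nil =>
    refine ⟨0, ?_⟩
    ext α : 1
    rw [alternatingMap_eq_zero_of_lt (by simpa using hn) (ω α)]
    simp [koszulD]
  | cons x rs ih =>
    rw [RingTheory.Sequence.isWeaklyRegular_cons_iff] at hreg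
    obtain ⟨N, w, hw⟩ := hω x (by simp)
    induction N generalizing w with
    | zero => exact ⟨w, by simpa using hw⟩
    | succ N ihN =>
      let w₀ : (Fin p → ℕ) → (Fin q → R) [⋀^Fin (n + 1)]→ₗ[R] L := Function.update w 0 0
      have hw₀ : koszulD φ w₀ = x ^ (N + 1) • ω := by
        rw [hw]
        exact koszulD_congr φ fun α hα => Function.update_of_ne hα _ _
      let wbar : (Fin p → ℕ) → (Fin q → R) [⋀^Fin (n + 1)]→ₗ[R] QuotSMulTop x L :=
        fun α => (Submodule.mkQ (x • ⊤ : Submodule R L)).compAlternatingMap (w₀ α)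
      have hcyc : koszulD φ wbar = 0 := by
        ext α v
        rw [koszulD_compAlternatingMap, hw₀]
        simp only [Pi.smul_apply, pow_succ', mul_smul, LinearMap.compAlternatingMap_apply,
          AlternatingMap.smul_apply, Pi.zero_apply, AlternatingMap.zero_apply, Submodule.mkQ_apply,
          Submodule.Quotient.mk_eq_zero]
        exact Submodule.smul_mem_pointwise_smul _ _ _ Submodule.mem_top
      have h0 : wbar 0 = 0 := by ext v; simp [wbar, w₀]
      obtain ⟨u, hu⟩ := ih (fun z hz => hrs z (by simp [hz])) hreg.2
        (by simp only [List.length_cons] at hn; omega) wbar fun z hz => by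
          obtain ⟨y, hy⟩ := hrs z (by simp [hz])
          exact exists_pow_smul_eq_koszulD hy wbar hcyc h0
      obtain ⟨u', w', hw'⟩ := exists_koszulD_add_smul hreg.1 φ w₀ u hu
      refine ihN w' ?_
      rw [hw', koszulD_add, koszulD_koszulD, zero_add, koszulD_smul, pow_succ', mul_smul] at hw₀
      ext α v
      exact hreg.1 (congrArg (fun f => f α v) hw₀.symm)

theorem pow_smul_single_eq_koszulD (φ : Fin p → V) {n : ℕ} {x : R}
    {ω : V [⋀^Fin n]→ₗ[R] L} (ζ : Fin p → V [⋀^Fin (n + 1)]→ₗ[R] L)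
    (hζ : x • ω = ∑ i, contract (φ i) (ζ i)) :
    x • Pi.single (0 : Fin p → ℕ) ω =
      koszulD φ (∑ i, Pi.single (Pi.single i 1 : Fin p → ℕ) (ζ i)) := by
  ext α : 1
  have hidx (b i : Fin p) : α + Pi.single b 1 = Pi.single i 1 ↔ α = 0 ∧ b = i := by
    refine ⟨fun h => ?_, by rintro ⟨rfl, rfl⟩; simp⟩
    have hbi : b = i := by
      by_contra hbi
      simpa [hbi] using congrFun h b
    subst hbi
    exact ⟨by simpa using h, rfl⟩
  simp only [koszulD, Finset.sum_apply, Pi.single_apply, hidx, Pi.smul_apply]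
  by_cases hα : α = 0
  · simp [hα, hζ]
  · simp [hα]

/-- Exactness of the Buchsbaum–Rim complex at its second term. -/
theorem exists_eq_iterContract {q : ℕ} (φ : Fin p → Fin q → R) (rs : List R)
    (hrs : ∀ x ∈ rs, ∃ y, IsScaledDual x φ y)
    (hreg : RingTheory.Sequence.IsWeaklyRegular L rs) (hne : rs ≠ []) (hn : q < p + rs.length)
    (g : (Fin q → R) [⋀^Fin 1]→ₗ[R] L) (hg : ∀ b, g (fun _ => φ b) = 0) :
    ∃ ω : (Fin q → R) [⋀^Fin (1 + p)]→ₗ[R] L, g = iterContract φ ω := by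
  obtain _ | ⟨x, rs⟩ := rs
  · exact absurd rfl hne
  rw [RingTheory.Sequence.isWeaklyRegular_cons_iff] at hreg
  obtain ⟨y, hy⟩ := hrs x (by simp)
  obtain ⟨ω, hω⟩ := exists_iterContract_eq_pow_smul hy g fun i v hv => by
    obtain ⟨j, hj⟩ := hv
    rw [← hg i]
    congr 1
    ext l : 1
    rw [← hj, Subsingleton.elim l j]
  obtain ⟨N, hN⟩ : ∃ N, iterContract φ ω = x ^ N • g := ⟨p, hω⟩
  clear hω
  induction N generalizing ω with
  | zero => exact ⟨ω, by simpa using hN.symm⟩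
  | succ N ih =>
    let ωbar := (Submodule.mkQ (x • ⊤ : Submodule R L)).compAlternatingMap ω
    have hωbar : iterContract φ ωbar = 0 := by
      rw [iterContract_compAlternatingMap, hN]
      ext v
      simp only [pow_succ', mul_smul, LinearMap.compAlternatingMap_apply,
        AlternatingMap.smul_apply, AlternatingMap.zero_apply, Submodule.mkQ_apply,
        Submodule.Quotient.mk_eq_zero]
      exact Submodule.smul_mem_pointwise_smul _ _ _ Submodule.mem_top
    obtain ⟨u, hu⟩ := exists_eq_koszulD φ rs (fun z hz => hrs z (by simp [hz])) hreg.2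
      (by simp only [List.length_cons] at hn; omega) (Pi.single 0 ωbar) fun z hz => by
        obtain ⟨y, hy⟩ := hrs z (by simp [hz])
        obtain ⟨ζ, hζ⟩ := exists_pow_smul_eq_sum_contract hy ωbar hωbar
        exact ⟨p, _, pow_smul_single_eq_koszulD φ ζ hζ⟩
    obtain ⟨u', w', hw'⟩ := exists_koszulD_add_smul hreg.1 φ (Pi.single 0 ω) u (by
      rw [← hu]
      ext α v
      by_cases hα : α = 0
      · subst hα; simp [ωbar]
      · simp [hα])
    refine ih (w' 0) ?_
    have h0 := congrFun hw' 0
    rw [Pi.single_eq_same, Pi.add_apply, Pi.smul_apply] at h0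
    rw [h0, map_add, koszulD, map_sum,
      Finset.sum_eq_zero fun b _ => iterContract_contract φ b _, zero_add, map_smul, pow_succ',
      mul_smul] at hN
    ext v
    exact hreg.1 (congrArg (fun f => f v) hN)

/-- An iterated contraction against `ψ` is the value of a functional separating `ψ s` from the
other members of `ψ`. -/
theorem exists_functional_iterContract {n k : ℕ} (ψ : Fin k → V)
    (ω : V [⋀^Fin (n + k)]→ₗ[R] L) (u : Fin n → V) (s : Fin k) :
    ∃ f : V →ₗ[R] L, (∀ i, f (ψ i) = if i = s then iterContract ψ ω u else 0) ∧
      ∀ z, (∀ v, z ∈ Set.range v → ω v = 0) → f z = 0 := by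
  induction k with
  | zero => exact s.elim0
  | succ k ih =>
    cases s using Fin.cases with
    | zero =>
      let f : V →ₗ[R] L :=
        { toFun := fun z => iterContract (n := n) (Fin.tail ψ) (contract (n := n + k) z ω) u
          map_add' := fun z z' => by
            rw [contract_add_left, map_add, AlternatingMap.add_apply]
          map_smul' := fun r z => by
            have : contract (n := n + k) (r • z) ω = r • contract (n := n + k) z ω :=
              map_smul (AlternatingMap.curryLeft (n := n + k) ω) r z
            rw [this, map_smul, AlternatingMap.smul_apply, RingHom.id_apply] }
      refine ⟨f, fun i => ?_, fun z hz => ?_⟩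
      · cases i using Fin.cases with
        | zero => rfl
        | succ i =>
          have := iterContract_contract (n := n) (Fin.tail ψ) i ω
          rw [if_neg (Fin.succ_ne_zero i)]
          exact congrArg (fun f => f u) this
      · have : contract (n := n + k) z ω = 0 := by
          ext v
          exact hz _ ⟨0, rfl⟩
        simp [f, this]
    | succ s =>
      obtain ⟨f, hf, hz⟩ := ih (Fin.tail ψ) (contract (n := n + k) (ψ 0) ω) s
      refine ⟨f, fun i => ?_, fun z h => hz z ?_⟩
      · cases i using Fin.cases with
        | zero =>
          rw [if_neg (Fin.succ_ne_zero s).symm]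
          refine hz _ ?_
          rintro v ⟨j, hj⟩
          exact AlternatingMap.map_eq_zero_of_eq (i := (0 : Fin (n + k + 1))) (j := j.succ) ω _
            (by simp [hj]) (Fin.succ_ne_zero j).symm
        | succ i =>
          simp only [Fin.succ_inj]
          exact hf i
      · rintro v ⟨j, hj⟩
        exact h _ ⟨j.succ, hj⟩

end Koszul

section Kernel

variable {R M : Type*} [CommRing R] [AddCommGroup M] [Module R M] {p q : ℕ}
  {Φ : Matrix (Fin p) (Fin q) R} {π : (Fin p → R) →ₗ[R] M}

theorem exists_isScaledDual_of_mem_annihilator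
    (hex : LinearMap.range Φ.mulVecLin = LinearMap.ker π) {x : R}
    (hx : x ∈ Module.annihilator R M) : ∃ y, IsScaledDual x (fun i => Φ i) y := by
  have (b : Fin p) : x • (Pi.single b 1 : Fin p → R) ∈ LinearMap.range Φ.mulVecLin := by
    rw [hex, LinearMap.mem_ker, map_smul, Module.mem_annihilator.mp hx]
  choose Y hY using this
  refine ⟨fun b => ∑ j, Y b j • LinearMap.proj j, fun b b' => ?_⟩
  have := congrFun (hY b) b'
  simp only [Matrix.mulVecLin_apply, Matrix.mulVec, dotProduct, Pi.smul_apply, smul_eq_mul,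
    Pi.single_apply, mul_ite, mul_one, mul_zero] at this
  simp only [LinearMap.sum_apply, LinearMap.smul_apply, LinearMap.proj_apply, smul_eq_mul,
    eq_comm (a := b), ← this, mul_comm]

theorem mem_annihilator_of_mulVec_eq_zero (hπ : Function.Surjective π)
    (hex : LinearMap.range Φ.mulVecLin = LinearMap.ker π) (rs : List R)
    (hrs : ∀ x ∈ rs, x ∈ Module.annihilator R M)
    (hreg : RingTheory.Sequence.IsWeaklyRegular R rs) (hne : rs ≠ []) (hn : q < p + rs.length)
    (v : Fin q → R) (hv : Φ.mulVec v = 0) (j : Fin q) : v j ∈ Module.annihilator R M := by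
  let g : (Fin q → R) [⋀^Fin 1]→ₗ[R] R :=
    AlternatingMap.ofSubsingleton R (Fin q → R) R (0 : Fin 1) (∑ l, v l • LinearMap.proj l)
  have hgapp (u : Fin q → R) : g (fun _ => u) = ∑ l, v l * u l := by
    simp [g, LinearMap.sum_apply]
  obtain ⟨ω, hω⟩ := exists_eq_iterContract (fun i => Φ i) rs
    (fun x hx => exists_isScaledDual_of_mem_annihilator hex (hrs x hx)) hreg hne hn g fun b => by
      rw [hgapp]
      simpa [Matrix.mulVec, dotProduct, mul_comm] using congrFun hv b
  have hvj : v j = iterContract (fun i => Φ i) ω (fun _ => Pi.single j 1) := by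
    rw [← hω, hgapp]
    simp [Pi.single_apply]
  have hsingle (s : Fin p) : v j • π (Pi.single s 1) = 0 := by
    obtain ⟨f, hf, -⟩ := exists_functional_iterContract (fun i => Φ i) ω
      (fun _ => Pi.single j 1) s
    rw [← map_smul, ← LinearMap.mem_ker, ← hex]
    refine ⟨fun l => f (Pi.single l 1), ?_⟩
    ext i
    have hfi : f (Φ i) = ∑ l, Φ i l * f (Pi.single l 1) := by
      conv_lhs => rw [pi_eq_sum_univ' (Φ i), map_sum]
      simp [map_smul]
    simp only [Matrix.mulVecLin_apply, Matrix.mulVec, dotProduct]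
    rw [← hfi, hf i, ← hvj]
    simp [Pi.single_apply]
  refine Module.mem_annihilator.mpr fun m => ?_
  obtain ⟨w, rfl⟩ := hπ m
  rw [pi_eq_sum_univ' w, map_sum, Finset.smul_sum]
  refine Finset.sum_eq_zero fun s _ => ?_
  rw [map_smul, smul_comm]
  rw [hsingle s, smul_zero]

theorem lcomp_bijective_of_apply_eq_zero {R G N M : Type*} [CommRing R] [AddCommGroup G]
    [Module R G] [AddCommGroup N] [Module R N] [AddCommGroup M] [Module R M] {ρ : G →ₗ[R] N}
    (hρ : Function.Surjective ρ) (h : ∀ f : G →ₗ[R] M, ∀ v, ρ v = 0 → f v = 0) :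
    Function.Bijective (LinearMap.lcomp R M ρ) := by
  refine ⟨fun f f' hff => LinearMap.ext fun x => ?_, fun f => ?_⟩
  · obtain ⟨v, rfl⟩ := hρ x
    exact LinearMap.congr_fun hff v
  · have hle : LinearMap.ker ρ ≤ LinearMap.ker f := fun v hv =>
      LinearMap.mem_ker.mpr (h f v (LinearMap.mem_ker.mp hv))
    refine ⟨(LinearMap.ker ρ).liftQ f hle ∘ₗ
      (ρ.quotKerEquivOfSurjective hρ).symm.toLinearMap, LinearMap.ext fun v => ?_⟩
    have : (ρ.quotKerEquivOfSurjective hρ).symm (ρ v) = (LinearMap.ker ρ).mkQ v := by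
      rw [LinearEquiv.symm_apply_eq]; rfl
    change (LinearMap.ker ρ).liftQ f hle ((ρ.quotKerEquivOfSurjective hρ).symm (ρ v)) = f v
    rw [this, Submodule.mkQ_apply, Submodule.liftQ_apply]

theorem exists_isWeaklyRegular_of_depthIn_eq {R N : Type*} [CommRing R] [AddCommGroup N]
    [Module R N] {J : Ideal R} {c : ℕ} (hc : c ≠ 0) (h : depthIn J N = c) :
    ∃ rs : List R, rs.length = c ∧ (∀ r ∈ rs, r ∈ J) ∧
      RingTheory.Sequence.IsWeaklyRegular N rs := by
  set S := {n : ℕ | ∃ rs : List R, rs.length = n ∧ (∀ r ∈ rs, r ∈ J) ∧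
    RingTheory.Sequence.IsRegular N rs}
  have hsup : sSup S = c := h
  have hne : S.Nonempty := by
    by_contra hS0
    rw [Set.not_nonempty_iff_eq_empty.mp hS0, csSup_empty] at hsup
    exact hc hsup.symm
  have hbdd : BddAbove S := by
    by_contra hb
    rw [Nat.sSup_of_not_bddAbove hb] at hsup
    exact hc hsup.symm
  obtain ⟨rs, hlen, hmem, hreg⟩ := hsup ▸ Nat.sSup_mem hne hbdd
  exact ⟨rs, hlen, hmem, hreg.toIsWeaklyRegular⟩

end Kernel

section Graded

variable {k R : Type*} [Field k] [CommRing R] [Algebra k R]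

theorem finite_homogeneousComponent [IsNoetherianRing R] (𝒜 : ℤ → Submodule k R)
    [GradedAlgebra 𝒜] (h0 : ∀ x ∈ 𝒜 0, ∃ r : k, algebraMap k R r = x) (d : ℤ) :
    Module.Finite k (𝒜 d) := by
  obtain ⟨t, ht, hspan⟩ := (Submodule.fg_span_iff_fg_span_finset_subset (R := R) (𝒜 d : Set R)).mp
    (IsNoetherian.noetherian (Ideal.span (𝒜 d : Set R)))
  rw [Module.Finite.iff_fg]
  refine ⟨t, le_antisymm (Submodule.span_le.mpr ht) fun x hx => ?_⟩
  have hx' : x ∈ Submodule.span R (t : Set R) := hspan ▸ Submodule.subset_span hx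
  obtain ⟨f, -, hf⟩ := Submodule.mem_span_finset.mp hx'
  have hcomp : x = ∑ s ∈ t, (DirectSum.decompose 𝒜 (f s) 0 : R) * s := by
    have hdec : (DirectSum.decompose 𝒜 x d : R) = x := DirectSum.decompose_of_mem_same 𝒜 hx
    rw [← hdec, ← hf, DirectSum.decompose_sum, DFinsupp.finsetSum_apply,
      AddSubmonoidClass.coe_finsetSum]
    refine Finset.sum_congr rfl fun s hs => ?_
    have := DirectSum.coe_decompose_mul_add_of_right_mem 𝒜 (i := 0) (a := f s) (ht hs)
    rwa [zero_add] at this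
  rw [hcomp]
  refine Submodule.sum_mem _ fun s hs => ?_
  obtain ⟨r, hr⟩ := h0 _ (DirectSum.decompose 𝒜 (f s) 0).2
  rw [← hr, ← Algebra.smul_def]
  exact Submodule.smul_mem _ _ (Submodule.subset_span hs)

end Graded

section Dimension

variable {k R M : Type} [Field k] [CommRing R] [Algebra k R]
  (𝒜 : ℤ → Submodule k R) [GradedAlgebra 𝒜] {p q : ℕ} (a : Fin q → ℤ) (b : Fin p → ℤ)
  {Φ : Matrix (Fin p) (Fin q) R} [AddCommGroup M] [Module R M] (π : (Fin p → R) →ₗ[R] M)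
  [Module k M] [IsScalarTower k R M]

theorem smul_mem_map_pi {d e : ℤ} {r : R} (hr : r ∈ 𝒜 e) {m : M}
    (hm : m ∈ Submodule.map (π.restrictScalars k) (Submodule.pi Set.univ fun i => 𝒜 (d - b i))) :
    r • m ∈ Submodule.map (π.restrictScalars k)
      (Submodule.pi Set.univ fun i => 𝒜 (e + d - b i)) := by
  obtain ⟨w, hw, rfl⟩ := hm
  refine ⟨r • w, fun i hi => ?_, by simp⟩
  change r * w i ∈ 𝒜 (e + d - b i)
  rw [add_sub_assoc]
  exact SetLike.mul_mem_graded hr (hw i hi)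

theorem exists_homogeneous_mulVec_eq (hΦ : ∀ i j, Φ i j ∈ 𝒜 (a j - b i)) {d : ℤ} (v : Fin q → R)
    (hv : ∀ i, Φ.mulVec v i ∈ 𝒜 (d - b i)) :
    ∃ v' : Fin q → R, (∀ j, v' j ∈ 𝒜 (d - a j)) ∧ Φ.mulVec v' = Φ.mulVec v := by
  refine ⟨fun j => DirectSum.decompose 𝒜 (v j) (d - a j), fun j => Subtype.property _, ?_⟩
  ext i
  have hdec := DirectSum.decompose_of_mem_same 𝒜 (hv i)
  rw [← hdec]
  simp only [Matrix.mulVec, dotProduct]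
  rw [DirectSum.decompose_sum, DFinsupp.finsetSum_apply, AddSubmonoidClass.coe_finsetSum]
  refine Finset.sum_congr rfl fun j _ => ?_
  have := DirectSum.coe_decompose_mul_add_of_left_mem 𝒜 (j := d - a j) (b := v j) (hΦ i j)
  rw [← this, show a j - b i + (d - a j) = d - b i by ring]

theorem finrank_degZeroHoms [IsNoetherianRing R] [SMulCommClass R k M]
    (h0 : ∀ x ∈ 𝒜 0, ∃ r : k, algebraMap k R r = x)
    (hΦ : ∀ i j, Φ i j ∈ 𝒜 (a j - b i)) (ρ : (Fin q → R) →ₗ[R] LinearMap.ker π)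
    (hρ : ∀ v, (ρ v : Fin p → R) = Φ.mulVecLin v) (hsurj : Function.Surjective ρ)
    (hbij : Function.Bijective (LinearMap.lcomp R M ρ)) :
    Module.finrank k (degZeroHoms (R := R)
        (fun d => {x : ↥(LinearMap.ker π) |
          (x : Fin p → R) ∈ Submodule.pi Set.univ fun i => 𝒜 (d - b i)})
        (fun d => Submodule.map (π.restrictScalars k)
          (Submodule.pi Set.univ fun i => 𝒜 (d - b i)))) =
      ∑ j, Module.finrank k ↥(Submodule.map (π.restrictScalars k)
        (Submodule.pi Set.univ fun i => 𝒜 (a j - b i))) := by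
  let ℳ : ℤ → Submodule k M := fun d => Submodule.map (π.restrictScalars k)
    (Submodule.pi Set.univ fun i => 𝒜 (d - b i))
  let 𝒩 : ℤ → Set (LinearMap.ker π) := fun d => {x : ↥(LinearMap.ker π) |
    (x : Fin p → R) ∈ Submodule.pi Set.univ fun i => 𝒜 (d - b i)}
  have hfin (d : ℤ) : Module.Finite k (ℳ d) := by
    have hA (e : ℤ) : Module.Finite k (𝒜 e) := finite_homogeneousComponent 𝒜 h0 e
    have : (Submodule.pi Set.univ fun i => 𝒜 (d - b i)).FG :=
      Submodule.fg_pi fun i => Module.Finite.iff_fg.mp (hA _)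
    exact Module.Finite.iff_fg.mpr (this.map _)
  have hcol (j : Fin q) : ρ (Pi.single j 1) ∈ 𝒩 (a j) := fun i _ => by
    rw [hρ]
    simpa using hΦ i j
  let ev : degZeroHoms (R := R) 𝒩 ℳ →ₗ[k] Π j, ℳ (a j) :=
    { toFun := fun f j => ⟨f.1 (ρ (Pi.single j 1)), f.2 _ _ (hcol j)⟩
      map_add' := fun _ _ => rfl
      map_smul' := fun _ _ => rfl }
  have hev : Function.Bijective ev := by
    refine ⟨fun f f' hff => Subtype.ext (hbij.1 ?_), fun m => ?_⟩
    · refine LinearMap.pi_ext' fun j => LinearMap.ext_ring ?_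
      exact congrArg Subtype.val (congrFun hff j)
    · obtain ⟨f, hf⟩ := hbij.2 (Fintype.linearCombination R fun j => (m j : M))
      have hfρ (v : Fin q → R) : f (ρ v) = ∑ j, v j • (m j : M) :=
        (LinearMap.congr_fun hf v).trans (Fintype.linearCombination_apply R _ v)
      have hmem : f ∈ degZeroHoms (R := R) 𝒩 ℳ := by
        intro d x hx
        obtain ⟨v, rfl⟩ := hsurj x
        obtain ⟨v', hv', heq⟩ := exists_homogeneous_mulVec_eq 𝒜 a b hΦ (d := d) v fun i => by
          have := hx i (Set.mem_univ i)
          rwa [hρ] at this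
        have hvv : ρ v = ρ v' := Subtype.ext (by rw [hρ, hρ]; exact heq.symm)
        rw [hvv, hfρ]
        refine Submodule.sum_mem _ fun j _ => ?_
        have := smul_mem_map_pi 𝒜 b π (hv' j) (m j).2
        rwa [sub_add_cancel] at this
      refine ⟨⟨f, hmem⟩, funext fun j => Subtype.ext ?_⟩
      change f (ρ (Pi.single j 1)) = _
      rw [hfρ]
      simp [Pi.single_apply]
  rw [← Module.finrank_pi_fintype k]
  exact (LinearEquiv.ofBijective ev hev).finrank_eq

end Dimension

end BuchsbaumRim

/-- with `N := ker (π : F* → M)`, precomposition with the corestriction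
`G* ↠ N` of `φ*` is an isomorphism `Hom_R(N, M) ≅ Hom_R(G*, M) ≅ ⊕ⱼ M(a j)`; in particular
the space of degree-preserving graded homomorphisms `N → M` has `k`-dimension
`∑ⱼ dim_k M_{a j}` (the degree-`d` component of `M` being the image under `π` of the
degree-`d` component of `F* = ⊕ᵢ R(-b i)`). -/
theorem statement1
    (k : Type) [Field k] (R : Type) [CommRing R] [Algebra k R] [IsNoetherianRing R]
    -- `R` is a graded `k`-algebra with `R₀ = k`, supported in nonnegative degrees,
    -- generated over `k` by finitely many homogeneous elements of positive degree
    (𝒜 : ℤ → Submodule k R) [GradedAlgebra 𝒜]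
    (h0 : ∀ x ∈ 𝒜 0, ∃ r : k, algebraMap k R r = x)
    (hneg : ∀ d : ℤ, d < 0 → 𝒜 d = ⊥)
    (hgen : ∃ S : Finset R, (∀ r ∈ S, ∃ d : ℤ, 0 < d ∧ r ∈ 𝒜 d) ∧
      Algebra.adjoin k (S : Set R) = ⊤)
    (p c : ℕ) (hp : 1 ≤ p) (hc : 2 ≤ c)
    (a : Fin (p + c - 1) → ℤ) (b : Fin p → ℤ)
    -- `Φ` is the homogeneous matrix representing `φ* : G* = ⊕ⱼ R(-a j) → F* = ⊕ᵢ R(-b i)`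
    (Φ : Matrix (Fin p) (Fin (p + c - 1)) R)
    (hΦ : ∀ i j, Φ i j ∈ 𝒜 (a j - b i))
    -- minimality of the presentation: homogeneous entries of nonpositive degree vanish
    (hmin : ∀ i j, a j - b i ≤ 0 → Φ i j = 0)
    -- `π : F* → M` is the presented module, with `range φ* = ker π`
    (M : Type) [AddCommGroup M] [Module R M]
    (π : (Fin p → R) →ₗ[R] M) (hπ : Function.Surjective π)
    (hex : LinearMap.range (Matrix.mulVecLin Φ) = LinearMap.ker π)
    -- `M` has maximal grade: `grade (ann M) = depth_{ann M} R = c` (`c = q - p + 1`)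
    (hgrade : depthIn (Module.annihilator R M) R = c)
    [Module k M] [IsScalarTower k R M] [SMulCommClass R k M] :
    (∀ ρ : (Fin (p + c - 1) → R) →ₗ[R] ↥(LinearMap.ker π),
      (∀ v, (ρ v : Fin p → R) = Matrix.mulVecLin Φ v) →
      Function.Bijective (LinearMap.lcomp R M ρ)) ∧
    Module.finrank k (degZeroHoms (R := R)
        (fun d => {x : ↥(LinearMap.ker π) |
          (x : Fin p → R) ∈ Submodule.pi Set.univ fun i => 𝒜 (d - b i)})
        (fun d => Submodule.map (π.restrictScalars k)
          (Submodule.pi Set.univ fun i => 𝒜 (d - b i)))) =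
      ∑ j, Module.finrank k ↥(Submodule.map (π.restrictScalars k)
        (Submodule.pi Set.univ fun i => 𝒜 (a j - b i))) := by
  obtain ⟨rs, hlen, hrs, hreg⟩ := BuchsbaumRim.exists_isWeaklyRegular_of_depthIn_eq
    (by omega : c ≠ 0) hgrade
  have hker (v : Fin (p + c - 1) → R) (hv : Φ.mulVecLin v = 0) (j : Fin (p + c - 1)) :
      v j ∈ Module.annihilator R M :=
    BuchsbaumRim.mem_annihilator_of_mulVec_eq_zero hπ hex rs hrs hreg
      (by rintro rfl; simp at hlen; omega) (by omega) v hv j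
  have hsurj (ρ : (Fin (p + c - 1) → R) →ₗ[R] ↥(LinearMap.ker π))
      (hρ : ∀ v, (ρ v : Fin p → R) = Matrix.mulVecLin Φ v) : Function.Surjective ρ := by
    rintro ⟨x, hx⟩
    obtain ⟨v, rfl⟩ := hex ▸ hx
    exact ⟨v, Subtype.ext (hρ v)⟩
  have hbij (ρ : (Fin (p + c - 1) → R) →ₗ[R] ↥(LinearMap.ker π))
      (hρ : ∀ v, (ρ v : Fin p → R) = Matrix.mulVecLin Φ v) :
      Function.Bijective (LinearMap.lcomp R M ρ) := by
    refine BuchsbaumRim.lcomp_bijective_of_apply_eq_zero (hsurj ρ hρ) fun f v hv => ?_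
    have hv0 : Φ.mulVecLin v = 0 := by rw [← hρ, hv]; rfl
    rw [pi_eq_sum_univ' v, map_sum]
    exact Finset.sum_eq_zero fun j _ => by
      rw [map_smul, Module.mem_annihilator.mp (hker v hv0 j)]
  refine ⟨hbij, ?_⟩
  let ρ := Φ.mulVecLin.codRestrict (LinearMap.ker π) fun v => hex ▸ LinearMap.mem_range_self _ v
  exact BuchsbaumRim.finrank_degZeroHoms 𝒜 a b π h0 hΦ ρ (fun _ => rfl) (hsurj ρ fun _ => rfl)
    (hbij ρ fun _ => rfl)

end
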